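/- Suppose the even positive integers L = L^{(J)} satisfy L^{(J)} → ∞ and (L^{(J)})²·τ_J → 0 as J → ∞, and let (ϑ_J)_{J∈ℕ} be reals with ϑ_J an integer multiple of τ_J for each J. If τ_J^{−1}·(ϑ_J − θ_j) → b as J → ∞ for some b ∈ ℝ, then \bar ρ_j(ϑ_J) → 2^j·R_j·∫_{Λ_{−j}} D(λ)·Π(λ)·e^{ibλ} dλ as J → ∞. -/

import Mathlib

noncomputable section

def Dfn (l : ℝ) : ℝ := (2 / Real.pi) * (Real.sin (l / 2)) ^ 2 / l ^ 2

def Pifn (p1 p2 : ℝ) (l : ℝ) : ℂ :=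
  (((1 - p1) * (1 - p2) : ℝ) : ℂ) /
    ((1 - (p1 : ℂ) * Complex.exp (Complex.I * l)) *
      (1 - (p2 : ℂ) * Complex.exp (-(Complex.I * l))))

def HLfn (L : ℕ) (l : ℝ) : ℝ :=
  2 * (Real.sin (l / 2)) ^ L *
    ∑ p ∈ Finset.range (L / 2), ((L / 2 - 1 + p).choose p : ℝ) * (Real.cos (l / 2)) ^ (2 * p)

def GLfn (L : ℕ) (l : ℝ) : ℝ := HLfn L (l - Real.pi)

def HjL (j L : ℕ) (l : ℝ) : ℝ :=
  HLfn L (2 ^ (j - 1) * l) * ∏ i ∈ Finset.range (j - 1), GLfn L (2 ^ i * l)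

def cL (L : ℕ) : ℝ := ((L - 2).choose (L / 2 - 1) : ℝ) * ((L : ℝ) - 1) / 2 ^ (L - 2)

def Lam (j : ℤ) : Set ℝ :=
  Set.Ico (-((2 : ℝ) ^ (j + 1) * Real.pi)) (-((2 : ℝ) ^ j * Real.pi)) ∪
    Set.Ioc ((2 : ℝ) ^ j * Real.pi) ((2 : ℝ) ^ (j + 1) * Real.pi)

def tauJ (J : ℕ) : ℝ := ((2 : ℝ) ^ (J + 1))⁻¹

def fJ (R θv : ℕ → ℝ) (J : ℕ) (l : ℝ) : ℂ :=
  ∑ i ∈ Finset.Icc 1 (J + 1),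
    ((R i : ℝ) : ℂ) * Complex.exp (-(Complex.I * (θv i : ℝ) * l)) *
      (Lam ((J : ℤ) - i + 1)).indicator (fun _ => (1 : ℂ)) l

def rhoBar (R θv : ℕ → ℝ) (p1 p2 : ℝ) (j L J : ℕ) (th : ℝ) : ℂ :=
  ∫ l : ℝ, ((Dfn l : ℝ) : ℂ) * ((HjL j L l : ℝ) : ℂ) * Pifn p1 p2 l *
    Complex.exp (Complex.I * ((tauJ J)⁻¹ * th) * l) * fJ R θv J ((tauJ J)⁻¹ * l)

def psiLP (s : ℝ) : ℝ :=
  if s = 0 then 1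
  else 2 * (Real.sin (2 * Real.pi * s) / (2 * Real.pi * s)) - Real.sin (Real.pi * s) / (Real.pi * s)

def psiLPj (j : ℤ) (t : ℝ) : ℝ := (2 : ℝ) ^ ((j : ℝ) / 2) * psiLP ((2 : ℝ) ^ j * t)


/-- With `Q m s = s ^ m * ∑_{p < m} C(m - 1 + p, p) * (1 - s) ^ p`, the Daubechies gain is
`2 * Q (L / 2) (sin² (l / 2))`. -/
def daubQ (m : ℕ) (s : ℝ) : ℝ :=
  s ^ m * ∑ p ∈ Finset.range m, ((m - 1 + p).choose p : ℝ) * (1 - s) ^ p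

theorem one_sub_mul_sum_choose (M n : ℕ) (y : ℝ) :
    (1 - y) * ∑ p ∈ Finset.range (n + 1), ((M + 1 + p).choose p : ℝ) * y ^ p =
      ∑ p ∈ Finset.range (n + 1), ((M + p).choose p : ℝ) * y ^ p -
        ((M + 1 + n).choose n : ℝ) * y ^ (n + 1) := by
  induction n with
  | zero => simp
  | succ n ih =>
    rw [Finset.sum_range_succ, mul_add, ih, Finset.sum_range_succ _ (n + 1)]
    have h : (M + 1 + (n + 1)).choose (n + 1) =
        (M + 1 + n).choose n + (M + (n + 1)).choose (n + 1) := by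
      rw [show M + 1 + (n + 1) = (M + 1 + n) + 1 by ring, Nat.choose_succ_succ]
      congr 2
      ring
    rw [h]
    push_cast
    ring

theorem daubQ_succ_succ (m : ℕ) (s : ℝ) :
    daubQ (m + 2) s = daubQ (m + 1) s +
      ((2 * m + 1).choose (m + 1) : ℝ) * (s * (1 - s)) ^ (m + 1) * (2 * s - 1) := by
  have h := one_sub_mul_sum_choose m (m + 1) (1 - s)
  rw [Finset.sum_range_succ (fun p => ((m + p).choose p : ℝ) * (1 - s) ^ p)] at h
  have hc : (m + 1 + (m + 1)).choose (m + 1) = 2 * (2 * m + 1).choose (m + 1) := by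
    rw [show m + 1 + (m + 1) = (2 * m + 1) + 1 by ring, Nat.choose_succ_succ,
      Nat.choose_symm_half]
    ring
  rw [hc, show m + (m + 1) = 2 * m + 1 by ring, sub_sub_cancel] at h
  unfold daubQ
  rw [show m + 2 = m + 1 + 1 from rfl, Nat.add_sub_cancel, Nat.add_sub_cancel, pow_succ s (m + 1),
    mul_assoc, h]
  push_cast
  rw [mul_pow]
  ring

theorem daubQ_add_daubQ_one_sub (m : ℕ) (s : ℝ) : daubQ (m + 1) s + daubQ (m + 1) (1 - s) = 1 := by
  induction m with
  | zero => simp [daubQ]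
  | succ m ih =>
    rw [daubQ_succ_succ, daubQ_succ_succ]
    rw [sub_sub_cancel, mul_comm (1 - s) s]
    linear_combination ih

theorem daubQ_nonneg (m : ℕ) {s : ℝ} (h0 : 0 ≤ s) (h1 : s ≤ 1) : 0 ≤ daubQ m s := by
  have : 0 ≤ 1 - s := by linarith
  unfold daubQ
  positivity

theorem daubQ_le_one {m : ℕ} (hm : 0 < m) {s : ℝ} (h0 : 0 ≤ s) (h1 : s ≤ 1) : daubQ m s ≤ 1 := by
  obtain ⟨n, rfl⟩ := Nat.exists_eq_succ_of_ne_zero hm.ne'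
  have h := daubQ_add_daubQ_one_sub n s
  have h' := daubQ_nonneg (n + 1) (s := 1 - s) (by linarith) (by linarith)
  simp only [Nat.succ_eq_add_one]
  linarith

theorem daubQ_le (m : ℕ) {s : ℝ} (h0 : 0 ≤ s) (h1 : s ≤ 1 / 2) :
    daubQ m s ≤ m * (4 * (s * (1 - s))) ^ m := by
  have hy : 1 ≤ 2 * (1 - s) := by linarith
  have hsum : ∑ p ∈ Finset.range m, ((m - 1 + p).choose p : ℝ) * (1 - s) ^ p ≤
      ∑ _p ∈ Finset.range m, 2 ^ m * (2 * (1 - s)) ^ m := by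
    refine Finset.sum_le_sum fun p hp => ?_
    have hpm := Finset.mem_range.1 hp
    have hc : ((m - 1 + p).choose p : ℝ) ≤ 2 ^ (m + p) := by
      exact_mod_cast (Nat.choose_le_two_pow _ _).trans
        (Nat.pow_le_pow_right (by norm_num) (by omega))
    have hpos : 0 ≤ (1 - s) ^ p := pow_nonneg (by linarith) p
    calc ((m - 1 + p).choose p : ℝ) * (1 - s) ^ p ≤ 2 ^ (m + p) * (1 - s) ^ p := by gcongr
      _ = 2 ^ m * (2 * (1 - s)) ^ p := by rw [pow_add, mul_pow, mul_assoc]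
      _ ≤ 2 ^ m * (2 * (1 - s)) ^ m := by gcongr
  calc daubQ m s ≤ s ^ m * ∑ _p ∈ Finset.range m, (2 : ℝ) ^ m * (2 * (1 - s)) ^ m := by
        unfold daubQ; gcongr
    _ = m * (4 * (s * (1 - s))) ^ m := by
        rw [Finset.sum_const, Finset.card_range, nsmul_eq_mul,
          show 4 * (s * (1 - s)) = s * 2 * (2 * (1 - s)) by ring]
        simp only [mul_pow]
        ring

open Filter in
theorem tendsto_daubQ_zero {s : ℝ} (h0 : 0 ≤ s) (h1 : s < 1 / 2) :
    Tendsto (fun m => daubQ m s) atTop (nhds 0) := by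
  refine squeeze_zero (fun m => daubQ_nonneg m h0 (by linarith)) (fun m => daubQ_le m h0 h1.le) ?_
  have hpos := mul_pos (sub_pos.2 h1) (sub_pos.2 h1)
  exact tendsto_self_mul_const_pow_of_lt_one (by nlinarith) (by linarith)

open Filter in
theorem tendsto_daubQ_one {s : ℝ} (h0 : 1 / 2 < s) (h1 : s ≤ 1) :
    Tendsto (fun m => daubQ m s) atTop (nhds 1) := by
  have h := (tendsto_daubQ_zero (s := 1 - s) (by linarith) (by linarith)).const_sub 1
  rw [sub_zero] at h
  refine h.congr' ?_
  filter_upwards [eventually_gt_atTop 0] with m hm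
  obtain ⟨n, rfl⟩ := Nat.exists_eq_succ_of_ne_zero hm.ne'
  have h := daubQ_add_daubQ_one_sub n s
  simp only [Nat.succ_eq_add_one]
  linarith

theorem HLfn_eq {L : ℕ} (hL : Even L) (l : ℝ) :
    HLfn L l = 2 * daubQ (L / 2) ((1 - Real.cos l) / 2) := by
  have hs : Real.sin (l / 2) ^ 2 = (1 - Real.cos l) / 2 := by
    have h := Real.cos_sq (l / 2)
    rw [mul_div_cancel₀ l two_ne_zero] at h
    rw [Real.sin_sq, h]
    ring
  have hc : Real.cos (l / 2) ^ 2 = 1 - (1 - Real.cos l) / 2 := by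
    rw [← hs, Real.cos_sq']
  unfold HLfn daubQ
  rw [← hs, ← pow_mul, Nat.mul_div_cancel' hL.two_dvd, mul_assoc]
  congr 3 with p
  rw [pow_mul, hc, hs]

theorem HLfn_nonneg {L : ℕ} (hL : Even L) (l : ℝ) : 0 ≤ HLfn L l := by
  rw [HLfn_eq hL]
  have := daubQ_nonneg (L / 2) (s := (1 - Real.cos l) / 2)
    (by linarith [Real.cos_le_one l]) (by linarith [Real.neg_one_le_cos l])
  positivity

theorem HLfn_le_two {L : ℕ} (hL : Even L) (hpos : 0 < L) (l : ℝ) : HLfn L l ≤ 2 := by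
  rw [HLfn_eq hL]
  have := daubQ_le_one (m := L / 2) (by obtain ⟨k, rfl⟩ := hL; omega)
    (s := (1 - Real.cos l) / 2)
    (by linarith [Real.cos_le_one l]) (by linarith [Real.neg_one_le_cos l])
  linarith

theorem GLfn_nonneg {L : ℕ} (hL : Even L) (l : ℝ) : 0 ≤ GLfn L l := HLfn_nonneg hL _

theorem GLfn_le_two {L : ℕ} (hL : Even L) (hpos : 0 < L) (l : ℝ) : GLfn L l ≤ 2 :=
  HLfn_le_two hL hpos _

theorem HjL_nonneg {j L : ℕ} (hL : Even L) (l : ℝ) : 0 ≤ HjL j L l :=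
  mul_nonneg (HLfn_nonneg hL _) (Finset.prod_nonneg fun _ _ => GLfn_nonneg hL _)

theorem HjL_le_HLfn {j L : ℕ} (hL : Even L) (hpos : 0 < L) (l : ℝ) :
    HjL j L l ≤ HLfn L (2 ^ (j - 1) * l) * 2 ^ (j - 1) := by
  unfold HjL
  refine mul_le_mul_of_nonneg_left ?_ (HLfn_nonneg hL _)
  refine (Finset.prod_le_prod (fun _ _ => GLfn_nonneg hL _)
    (fun _ _ => GLfn_le_two hL hpos _)).trans ?_
  simp

theorem HjL_le_two_pow {j L : ℕ} (hj : 1 ≤ j) (hL : Even L) (hpos : 0 < L) (l : ℝ) :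
    HjL j L l ≤ 2 ^ j := by
  refine (HjL_le_HLfn hL hpos l).trans ?_
  calc HLfn L (2 ^ (j - 1) * l) * 2 ^ (j - 1) ≤ 2 * 2 ^ (j - 1) := by
        gcongr; exact HLfn_le_two hL hpos _
    _ = 2 ^ j := by rw [← pow_succ', Nat.sub_add_cancel hj]

theorem HjL_le_GLfn {j L : ℕ} (hL : Even L) (hpos : 0 < L) (l : ℝ) {k : ℕ} (hk : k < j - 1) :
    HjL j L l ≤ GLfn L (2 ^ k * l) * 2 ^ (j - 1) := by
  have hmem : k ∈ Finset.range (j - 1) := Finset.mem_range.2 hk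
  have hprod : ∏ i ∈ (Finset.range (j - 1)).erase k, GLfn L (2 ^ i * l) ≤ 2 ^ (j - 2) := by
    refine (Finset.prod_le_prod (fun _ _ => GLfn_nonneg hL _)
      (fun _ _ => GLfn_le_two hL hpos _)).trans ?_
    rw [Finset.prod_const, Finset.card_erase_of_mem hmem, Finset.card_range]
    exact le_of_eq (by congr 1)
  unfold HjL
  rw [← Finset.mul_prod_erase _ _ hmem]
  have hG := GLfn_nonneg hL (2 ^ k * l)
  calc _ ≤ 2 * (GLfn L (2 ^ k * l) * 2 ^ (j - 2)) :=
        mul_le_mul (HLfn_le_two hL hpos _) (mul_le_mul_of_nonneg_left hprod hG)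
          (mul_nonneg hG (Finset.prod_nonneg fun _ _ => GLfn_nonneg hL _)) zero_le_two
    _ = GLfn L (2 ^ k * l) * 2 ^ (j - 1) := by
        rw [show j - 1 = (j - 2) + 1 by omega, pow_succ]; ring

section Limits

open Filter

variable {L : ℕ → ℕ}

theorem tendsto_HLfn_two (hLeven : ∀ J, Even (L J)) (hL : Tendsto L atTop atTop) {l : ℝ}
    (hl : Real.cos l < 0) : Tendsto (fun J => HLfn (L J) l) atTop (nhds 2) := by
  simp only [fun J => HLfn_eq (hLeven J) l]
  have h := tendsto_daubQ_one (s := (1 - Real.cos l) / 2) (by linarith)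
    (by linarith [Real.neg_one_le_cos l])
  simpa using ((h.comp ((Nat.tendsto_div_const_atTop two_ne_zero).comp hL)).const_mul 2)

theorem tendsto_HLfn_zero (hLeven : ∀ J, Even (L J)) (hL : Tendsto L atTop atTop) {l : ℝ}
    (hl : 0 < Real.cos l) : Tendsto (fun J => HLfn (L J) l) atTop (nhds 0) := by
  simp only [fun J => HLfn_eq (hLeven J) l]
  have h := tendsto_daubQ_zero (s := (1 - Real.cos l) / 2) (by linarith [Real.cos_le_one l])
    (by linarith)
  simpa using ((h.comp ((Nat.tendsto_div_const_atTop two_ne_zero).comp hL)).const_mul 2)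

theorem tendsto_GLfn_two (hLeven : ∀ J, Even (L J)) (hL : Tendsto L atTop atTop) {l : ℝ}
    (hl : 0 < Real.cos l) : Tendsto (fun J => GLfn (L J) l) atTop (nhds 2) :=
  tendsto_HLfn_two hLeven hL (by rw [Real.cos_sub_pi]; linarith)

theorem tendsto_GLfn_zero (hLeven : ∀ J, Even (L J)) (hL : Tendsto L atTop atTop) {l : ℝ}
    (hl : Real.cos l < 0) : Tendsto (fun J => GLfn (L J) l) atTop (nhds 0) :=
  tendsto_HLfn_zero hLeven hL (by rw [Real.cos_sub_pi]; linarith)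

end Limits

theorem mem_Lam {k : ℤ} {x : ℝ} :
    x ∈ Lam k ↔ (2 : ℝ) ^ k * Real.pi < |x| ∧ |x| ≤ (2 : ℝ) ^ (k + 1) * Real.pi := by
  have hpos : 0 < (2 : ℝ) ^ k * Real.pi := by positivity
  simp only [Lam, Set.mem_union, Set.mem_Ico, Set.mem_Ioc]
  rcases le_total 0 x with hx | hx
  · rw [abs_of_nonneg hx]
    constructor
    · rintro (h | h)
      · linarith [h.2]
      · exact h
    · exact Or.inr
  · rw [abs_of_nonpos hx]
    constructor
    · rintro (h | h)
      · constructor <;> linarith [h.1, h.2]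
      · linarith [h.1]
    · intro h
      left
      constructor <;> linarith [h.1, h.2]

theorem measurableSet_Lam (k : ℤ) : MeasurableSet (Lam k) :=
  measurableSet_Ico.union measurableSet_Ioc

theorem Lam_index_unique {k k' : ℤ} {x : ℝ} (h : x ∈ Lam k) (h' : x ∈ Lam k') : k = k' := by
  have key : ∀ {a c : ℤ}, x ∈ Lam a → x ∈ Lam c → a ≤ c := by
    intro a c ha hc
    have h1 := (mem_Lam.1 ha).1.trans_le (mem_Lam.1 hc).2
    have h2 := lt_of_mul_lt_mul_right h1 Real.pi_pos.le
    have := (zpow_lt_zpow_iff_right₀ (one_lt_two (α := ℝ))).1 h2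
    omega
  exact le_antisymm (key h h') (key h' h)

theorem inv_tauJ (J : ℕ) : (tauJ J)⁻¹ = (2 : ℝ) ^ (J + 1) := inv_inv _

theorem inv_tauJ_mul_mem_Lam (J i : ℕ) (l : ℝ) :
    (tauJ J)⁻¹ * l ∈ Lam ((J : ℤ) - i + 1) ↔ l ∈ Lam (-(i : ℤ)) := by
  have hpos : (0 : ℝ) < 2 ^ (J + 1) := by positivity
  have h1 : (2 : ℝ) ^ ((J : ℤ) - i + 1) = 2 ^ (J + 1) * (2 : ℝ) ^ (-(i : ℤ)) := by
    rw [← zpow_natCast, ← zpow_add₀ two_ne_zero]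
    congr 1
    push_cast
    ring
  have h2 : (2 : ℝ) ^ ((J : ℤ) - i + 1 + 1) = 2 ^ (J + 1) * (2 : ℝ) ^ (-(i : ℤ) + 1) := by
    rw [← zpow_natCast, ← zpow_add₀ two_ne_zero]
    congr 1
    push_cast
    ring
  rw [mem_Lam, mem_Lam, inv_tauJ, abs_mul, abs_of_pos hpos, h1, h2, mul_assoc, mul_assoc,
    mul_lt_mul_iff_right₀ hpos, mul_le_mul_iff_right₀ hpos]

theorem fJ_eq_of_mem (R θv : ℕ → ℝ) {J i : ℕ} (hi : 1 ≤ i) (hiJ : i ≤ J + 1) {l : ℝ}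
    (hl : l ∈ Lam (-(i : ℤ))) :
    fJ R θv J ((tauJ J)⁻¹ * l) =
      (R i : ℂ) * Complex.exp (-(Complex.I * (θv i : ℝ) * ((tauJ J)⁻¹ * l : ℝ))) := by
  unfold fJ
  rw [Finset.sum_eq_single i]
  · rw [Set.indicator_of_mem ((inv_tauJ_mul_mem_Lam J i l).2 hl), mul_one]
  · intro i' _ hne
    rw [Set.indicator_of_notMem, mul_zero]
    intro h
    have := Lam_index_unique ((inv_tauJ_mul_mem_Lam J i' l).1 h) hl
    omega
  · intro h
    exact absurd (Finset.mem_Icc.2 ⟨hi, hiJ⟩) h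

theorem fJ_eq_zero (R θv : ℕ → ℝ) {J : ℕ} {l : ℝ}
    (hl : ∀ i ∈ Finset.Icc 1 (J + 1), l ∉ Lam (-(i : ℤ))) :
    fJ R θv J ((tauJ J)⁻¹ * l) = 0 := by
  refine Finset.sum_eq_zero fun i hi => ?_
  rw [Set.indicator_of_notMem (fun h => hl i hi ((inv_tauJ_mul_mem_Lam J i l).1 h)), mul_zero]

theorem norm_fJ_le_one {R : ℕ → ℝ} (hR : ∀ i, R i ∈ Set.Icc (-1 : ℝ) 1) (θv : ℕ → ℝ) (J : ℕ)
    (l : ℝ) : ‖fJ R θv J ((tauJ J)⁻¹ * l)‖ ≤ 1 := by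
  by_cases h : ∃ i ∈ Finset.Icc 1 (J + 1), l ∈ Lam (-(i : ℤ))
  · obtain ⟨i, hi, hl⟩ := h
    obtain ⟨h1, h2⟩ := Finset.mem_Icc.1 hi
    rw [fJ_eq_of_mem R θv h1 h2 hl, norm_mul, Complex.norm_real, Complex.norm_exp]
    simpa using abs_le.2 (hR i)
  · push Not at h
    rw [fJ_eq_zero R θv h]
    simp

theorem abs_le_pi_of_mem_Lam {i : ℕ} (hi : 1 ≤ i) {l : ℝ} (hl : l ∈ Lam (-(i : ℤ))) :
    |l| ≤ Real.pi := by
  refine (mem_Lam.1 hl).2.trans ?_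
  have : (2 : ℝ) ^ (-(i : ℤ) + 1) ≤ 1 := zpow_le_one_of_nonpos₀ one_le_two (by omega)
  nlinarith [Real.pi_pos]

theorem fJ_eq_zero_of_pi_lt (R θv : ℕ → ℝ) (J : ℕ) {l : ℝ} (hl : Real.pi < |l|) :
    fJ R θv J ((tauJ J)⁻¹ * l) = 0 :=
  fJ_eq_zero R θv fun _ hi h =>
    hl.not_ge (abs_le_pi_of_mem_Lam (Finset.mem_Icc.1 hi).1 h)

theorem norm_Dfn_le_one (l : ℝ) : ‖((Dfn l : ℝ) : ℂ)‖ ≤ 1 := by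
  rw [Complex.norm_real, Real.norm_eq_abs]
  have h : Dfn l = (2 / Real.pi) * (Real.sin (l / 2) ^ 2 / l ^ 2) := mul_div_assoc _ _ _
  have hpi : 2 / Real.pi ≤ 1 := (div_le_one Real.pi_pos).2 Real.two_le_pi
  have hq : Real.sin (l / 2) ^ 2 / l ^ 2 ≤ 1 := by
    refine div_le_one_of_le₀ ?_ (sq_nonneg l)
    have h1 := sq_le_sq.2 (Real.abs_sin_le_abs (x := l / 2))
    nlinarith [sq_nonneg l]
  rw [h, abs_of_nonneg (by positivity)]
  exact mul_le_one₀ hpi (by positivity) hq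

theorem norm_Pifn_le_one {p1 p2 : ℝ} (hp1 : p1 ∈ Set.Ico (0 : ℝ) 1) (hp2 : p2 ∈ Set.Ico (0 : ℝ) 1)
    (l : ℝ) : ‖Pifn p1 p2 l‖ ≤ 1 := by
  have key : ∀ {p : ℝ} {z : ℂ}, p ∈ Set.Ico (0 : ℝ) 1 → ‖z‖ = 1 → 1 - p ≤ ‖1 - (p : ℂ) * z‖ := by
    intro p z hp hz
    have h := norm_sub_norm_le (1 : ℂ) ((p : ℂ) * z)
    rwa [norm_mul, hz, Complex.norm_real, Real.norm_eq_abs, abs_of_nonneg hp.1, norm_one,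
      mul_one] at h
  have e1 : ‖Complex.exp (Complex.I * l)‖ = 1 := by simp [Complex.norm_exp]
  have e2 : ‖Complex.exp (-(Complex.I * l))‖ = 1 := by simp [Complex.norm_exp]
  have h1 : 0 < 1 - p1 := sub_pos.2 hp1.2
  have h2 : 0 < 1 - p2 := sub_pos.2 hp2.2
  unfold Pifn
  rw [norm_div, norm_mul, Complex.norm_real, Real.norm_eq_abs, abs_of_pos (mul_pos h1 h2)]
  refine div_le_one_of_le₀ ?_ (by positivity)
  exact mul_le_mul (key hp1 e1) (key hp2 e2) h2.le (norm_nonneg _)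

@[fun_prop]
theorem measurable_Dfn : Measurable Dfn := by unfold Dfn; fun_prop

@[fun_prop]
theorem measurable_Pifn (p1 p2 : ℝ) : Measurable (Pifn p1 p2) := by unfold Pifn; fun_prop

@[fun_prop]
theorem measurable_HjL (j L : ℕ) : Measurable (HjL j L) := by
  unfold HjL GLfn HLfn; fun_prop

@[fun_prop]
theorem measurable_fJ (R θv : ℕ → ℝ) (J : ℕ) : Measurable (fJ R θv J) := by
  unfold fJ
  refine Finset.measurable_sum _ fun i _ => ?_
  have : Measurable ((Lam ((J : ℤ) - i + 1)).indicator fun _ => (1 : ℂ)) :=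
    measurable_const.indicator (measurableSet_Lam _)
  fun_prop

theorem cos_mul_pos {a l : ℝ} (ha : 0 < a) (h : a * |l| < Real.pi / 2) : 0 < Real.cos (a * l) := by
  rw [← Real.cos_abs, abs_mul, abs_of_pos ha]
  exact Real.cos_pos_of_mem_Ioo ⟨by linarith [mul_nonneg ha.le (abs_nonneg l), Real.pi_pos], h⟩

theorem cos_mul_neg {a l : ℝ} (ha : 0 < a) (h : Real.pi / 2 < a * |l|) (h' : a * |l| ≤ Real.pi) :
    Real.cos (a * l) < 0 := by
  rw [← Real.cos_abs, abs_mul, abs_of_pos ha]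
  exact Real.cos_neg_of_pi_div_two_lt_of_lt h (by linarith [Real.pi_pos])

/-- On the `i`-th dyadic shell the rescaled frequency `2 ^ (i - 1) * |l|` lies in `(π / 2, π]`. -/
theorem mem_Lam_neg {i : ℕ} {l : ℝ} (hi : 1 ≤ i) :
    l ∈ Lam (-(i : ℤ)) ↔
      Real.pi / 2 < 2 ^ (i - 1) * |l| ∧ 2 ^ (i - 1) * |l| ≤ Real.pi := by
  obtain ⟨n, rfl⟩ := Nat.exists_eq_add_of_le' hi
  have hpos : (0 : ℝ) < 2 ^ n := by positivity
  have h1 : (2 : ℝ) ^ (-((n + 1 : ℕ) : ℤ)) * Real.pi = Real.pi / 2 / 2 ^ n := by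
    rw [zpow_neg, zpow_natCast, pow_succ]
    field_simp
  have h2 : (2 : ℝ) ^ (-((n + 1 : ℕ) : ℤ) + 1) * Real.pi = Real.pi / 2 ^ n := by
    rw [show -((n + 1 : ℕ) : ℤ) + 1 = -(n : ℤ) by push_cast; ring, zpow_neg, zpow_natCast]
    field_simp
  rw [mem_Lam, h1, h2, div_lt_iff₀' hpos, le_div_iff₀' hpos, Nat.add_sub_cancel]

section Limits

open Filter

variable {L : ℕ → ℕ} {j : ℕ}

theorem tendsto_HjL_of_mem (hj : 1 ≤ j) (hLeven : ∀ J, Even (L J)) (hL : Tendsto L atTop atTop)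
    {l : ℝ} (hl : l ∈ Lam (-(j : ℤ))) (hne : 2 ^ (j - 1) * |l| ≠ Real.pi) :
    Tendsto (fun J => HjL j (L J) l) atTop (nhds (2 ^ j)) := by
  obtain ⟨h1, h2⟩ := (mem_Lam_neg hj).1 hl
  have hH := tendsto_HLfn_two hLeven hL (cos_mul_neg (by positivity) h1 h2)
  have hG := tendsto_finsetProd (Finset.range (j - 1)) (f := fun i J => GLfn (L J) (2 ^ i * l))
    (a := fun _ => (2 : ℝ)) (x := atTop) fun i hi => by
      refine tendsto_GLfn_two hLeven hL (cos_mul_pos (by positivity) ?_)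
      have hlt : i + 1 ≤ j - 1 := Finset.mem_range.1 hi
      have : (2 : ℝ) ^ (i + 1) * |l| ≤ 2 ^ (j - 1) * |l| := by
        gcongr
        exact one_le_two
      rw [pow_succ] at this
      linarith [lt_of_le_of_ne h2 hne]
  have h := hH.mul hG
  rwa [Finset.prod_const, Finset.card_range, ← pow_succ', Nat.sub_add_cancel hj] at h

theorem tendsto_HjL_of_mem_of_ne (hj : 1 ≤ j) (hLeven : ∀ J, Even (L J)) (hLpos : ∀ J, 0 < L J)
    (hL : Tendsto L atTop atTop) {i : ℕ} (hi : 1 ≤ i) (hij : i ≠ j)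
    {l : ℝ} (hl : l ∈ Lam (-(i : ℤ))) (hne : 2 ^ (j - 1) * |l| ≠ Real.pi / 2) :
    Tendsto (fun J => HjL j (L J) l) atTop (nhds 0) := by
  obtain ⟨h1, h2⟩ := (mem_Lam_neg hi).1 hl
  rcases hij.lt_or_gt with h | h
  · refine squeeze_zero (fun J => HjL_nonneg (hLeven J) l)
      (fun J => HjL_le_GLfn (hLeven J) (hLpos J) l (k := i - 1) (by omega)) ?_
    simpa using (tendsto_GLfn_zero hLeven hL (cos_mul_neg (by positivity) h1 h2)).mul_const
      ((2 : ℝ) ^ (j - 1))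
  · refine squeeze_zero (fun J => HjL_nonneg (hLeven J) l)
      (fun J => HjL_le_HLfn (hLeven J) (hLpos J) l) ?_
    have hlt : 2 ^ (j - 1) * |l| < Real.pi / 2 := by
      refine lt_of_le_of_ne ?_ hne
      have : (2 : ℝ) ^ (j - 1 + 1) * |l| ≤ 2 ^ (i - 1) * |l| := by
        gcongr
        · exact one_le_two
        · omega
      rw [pow_succ] at this
      linarith
    simpa using (tendsto_HLfn_zero hLeven hL (cos_mul_pos (by positivity) hlt)).mul_const
      ((2 : ℝ) ^ (j - 1))

end Limits

theorem ae_two_pow_mul_abs_ne (n : ℕ) {c : ℝ} :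
    ∀ᵐ l : ℝ, 2 ^ n * |l| ≠ c := by
  have hfin : ({c / 2 ^ n, -(c / 2 ^ n)} : Set ℝ).Countable := Set.to_countable _
  filter_upwards [hfin.ae_notMem MeasureTheory.volume] with l hl h
  apply hl
  have h' : |l| = c / 2 ^ n := by
    rw [← h]
    field_simp
  rcases abs_choice l with e | e
  · left; rw [← h', e]
  · right; rw [← h', e]; simp

theorem norm_rhoBar_integrand_le {R : ℕ → ℝ} (hR : ∀ i, R i ∈ Set.Icc (-1 : ℝ) 1) (θv : ℕ → ℝ)
    {p1 p2 : ℝ} (hp1 : p1 ∈ Set.Ico (0 : ℝ) 1) (hp2 : p2 ∈ Set.Ico (0 : ℝ) 1)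
    {j L : ℕ} (hL : Even L) (J : ℕ) (th l : ℝ) :
    ‖((Dfn l : ℝ) : ℂ) * ((HjL j L l : ℝ) : ℂ) * Pifn p1 p2 l *
      Complex.exp (Complex.I * ((tauJ J)⁻¹ * th) * l) * fJ R θv J ((tauJ J)⁻¹ * l)‖ ≤
        HjL j L l := by
  have hH := HjL_nonneg (j := j) hL l
  have hE : ‖Complex.exp (Complex.I * ((tauJ J)⁻¹ * th) * l)‖ = 1 := by
    rw [show Complex.I * (((tauJ J)⁻¹ : ℝ) * th : ℂ) * l =
      (((tauJ J)⁻¹ * th * l : ℝ) : ℂ) * Complex.I by push_cast; ring]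
    exact Complex.norm_exp_ofReal_mul_I _
  rw [norm_mul, norm_mul, norm_mul, norm_mul, hE, mul_one, Complex.norm_real (HjL j L l),
    Real.norm_eq_abs, abs_of_nonneg hH]
  calc _ ≤ 1 * HjL j L l * 1 * 1 := by
        gcongr
        · exact norm_Dfn_le_one l
        · exact norm_Pifn_le_one hp1 hp2 l
        · exact norm_fJ_le_one hR θv J l
    _ = HjL j L l := by ring

open Filter in
theorem statement3
    (j : ℕ) (hj : 1 ≤ j) (R θv : ℕ → ℝ) (hR : ∀ i, R i ∈ Set.Icc (-1 : ℝ) 1)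
    (p1 p2 : ℝ) (hp1 : p1 ∈ Set.Ico (0 : ℝ) 1) (hp2 : p2 ∈ Set.Ico (0 : ℝ) 1)
    (L : ℕ → ℕ) (hLeven : ∀ J, Even (L J)) (hLpos : ∀ J, 0 < L J)
    (hLinf : Tendsto (fun J => (L J : ℝ)) atTop atTop)
    (hL2tau : Tendsto (fun J => (L J : ℝ) ^ 2 * tauJ J) atTop (nhds 0))
    (ϑ : ℕ → ℝ) (hgrid : ∀ J, ∃ k : ℤ, ϑ J = (k : ℝ) * tauJ J)
    (b : ℝ)
    (hb : Tendsto (fun J => (tauJ J)⁻¹ * (ϑ J - θv j)) atTop (nhds b)) :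
    Tendsto (fun J => rhoBar R θv p1 p2 j (L J) J (ϑ J)) atTop
      (nhds ((2 : ℂ) ^ j * (R j : ℝ) *
        ∫ l in Lam (-(j : ℤ)), ((Dfn l : ℝ) : ℂ) * Pifn p1 p2 l *
          Complex.exp (Complex.I * b * l))) := by
  have hL : Tendsto L atTop atTop := tendsto_natCast_atTop_iff.1 hLinf
  rw [← MeasureTheory.integral_const_mul,
    ← MeasureTheory.integral_indicator (measurableSet_Lam _)]
  unfold rhoBar
  refine MeasureTheory.tendsto_integral_of_dominated_convergence
    ((Set.Icc (-Real.pi) Real.pi).indicator fun _ => (2 : ℝ) ^ j) ?_ ?_ ?_ ?_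
  · intro J
    apply Measurable.aestronglyMeasurable
    fun_prop
  · exact (MeasureTheory.integrable_indicator_iff measurableSet_Icc).2
      (MeasureTheory.integrableOn_const measure_Icc_lt_top.ne)
  · intro J
    filter_upwards with l
    by_cases hl : |l| ≤ Real.pi
    · rw [Set.indicator_of_mem (Set.mem_Icc.2 (abs_le.1 hl))]
      exact (norm_rhoBar_integrand_le hR θv hp1 hp2 (hLeven J) J (ϑ J) l).trans
        (HjL_le_two_pow hj (hLeven J) (hLpos J) l)
    · rw [fJ_eq_zero_of_pi_lt R θv J (not_le.1 hl), mul_zero, norm_zero]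
      exact Set.indicator_nonneg (fun _ _ => by positivity) l
  · filter_upwards [ae_two_pow_mul_abs_ne (j - 1) (c := Real.pi),
      ae_two_pow_mul_abs_ne (j - 1) (c := Real.pi / 2)] with l hne hne'
    by_cases hl : l ∈ Lam (-(j : ℤ))
    · rw [Set.indicator_of_mem hl]
      have hH : Tendsto (fun J => ((HjL j (L J) l : ℝ) : ℂ)) atTop (nhds (((2 : ℝ) ^ j : ℝ) : ℂ)) :=
        (Complex.continuous_ofReal.tendsto _).comp (tendsto_HjL_of_mem hj hLeven hL hl hne)
      have hE : Tendsto (fun J => Complex.exp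
          (Complex.I * (((tauJ J)⁻¹ * (ϑ J - θv j) : ℝ) : ℂ) * l)) atTop
          (nhds (Complex.exp (Complex.I * b * l))) := by
        have hc : Continuous fun x : ℝ => Complex.exp (Complex.I * (x : ℂ) * l) := by fun_prop
        exact (hc.tendsto b).comp hb
      have h := ((hH.mul hE).const_mul (((Dfn l : ℝ) : ℂ) * Pifn p1 p2 l * (R j : ℂ)))
      convert h.congr' ?_ using 2
      · push_cast
        ring
      · filter_upwards [eventually_ge_atTop j] with J hJ
        rw [fJ_eq_of_mem R θv hj (by omega) hl,
          show Complex.I * (((tauJ J)⁻¹ * (ϑ J - θv j) : ℝ) : ℂ) * l =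
            Complex.I * (((tauJ J)⁻¹ : ℝ) * ϑ J : ℂ) * l +
              -(Complex.I * (θv j : ℝ) * ((tauJ J)⁻¹ * l : ℝ)) by push_cast; ring,
          Complex.exp_add]
        push_cast
        ring
    · rw [Set.indicator_of_notMem hl]
      by_cases hex : ∃ i : ℕ, 1 ≤ i ∧ l ∈ Lam (-(i : ℤ))
      · obtain ⟨i, hi, hli⟩ := hex
        have hij : i ≠ j := fun h => hl (h ▸ hli)
        exact squeeze_zero_norm
          (fun J => norm_rhoBar_integrand_le hR θv hp1 hp2 (hLeven J) J (ϑ J) l)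
          (tendsto_HjL_of_mem_of_ne hj hLeven hLpos hL hi hij hli hne')
      · push Not at hex
        refine tendsto_const_nhds.congr fun J => ?_
        rw [fJ_eq_zero R θv fun i hi => hex i (Finset.mem_Icc.1 hi).1, mul_zero]

end
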